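/- Let G be a finite connected simple graph with girth g ≥ 5, g ≡ 0 or 1 (mod 4), suppose G is not a canonical unicyclic graph and n(G) = ⌈g/2⌉, and let C be a shortest cycle in G. Then the set N_2(C) of vertices of G at distance exactly 2 from V(C) is an independent set (no two of its vertices are adjacent). -/

import Mathlib

/-- The real adjacency matrix of a simple graph is Hermitian. -/
lemma SimpleGraph.adjMatrix_isHermitian {V : Type*} [Fintype V] [DecidableEq V]
    (G : SimpleGraph V) [DecidableRel G.Adj] : (G.adjMatrix ℝ).IsHermitian := by
  rw [Matrix.IsHermitian, Matrix.conjTranspose_eq_transpose_of_trivial]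
  exact G.isSymm_adjMatrix

/-- The negative inertia index `n(G)`: the number of negative eigenvalues of the real
adjacency matrix of `G`, counted with multiplicity. -/
noncomputable def SimpleGraph.negInertia {V : Type*} [Fintype V] (G : SimpleGraph V) : ℕ := by
  classical
  exact Fintype.card {i // (G.adjMatrix_isHermitian).eigenvalues i < 0}

/-- The positive inertia index `p(G)`: the number of positive eigenvalues of the real
adjacency matrix of `G`, counted with multiplicity. -/
noncomputable def SimpleGraph.posInertia {V : Type*} [Fintype V] (G : SimpleGraph V) : ℕ := by
  classical
  exact Fintype.card {i // 0 < (G.adjMatrix_isHermitian).eigenvalues i}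

/-- A connected graph is a *canonical unicyclic graph* if it has exactly one cycle `C`
(any two cycles have the same edge set) and the vertices outside `C` form an
independent set. -/
def SimpleGraph.IsCanonicalUnicyclic {V : Type*} (G : SimpleGraph V) : Prop :=
  G.Connected ∧
    ∃ (a : V) (c : G.Walk a a), c.IsCycle ∧
      (∀ (b : V) (d : G.Walk b b), d.IsCycle → ∀ e, e ∈ d.edges ↔ e ∈ c.edges) ∧
      (∀ x y : V, x ∉ c.support → y ∉ c.support → ¬ G.Adj x y)

open Matrix in
/-- If a Hermitian real matrix `A` vanishes as a quadratic form on the range of `P`, and no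
nonzero vector is annihilated by `A * P`, then `A` has at least as many negative eigenvalues as
`P` has columns. -/
lemma Matrix.IsHermitian.card_le_card_neg_eigenvalues {n ι : Type*} [Fintype n] [DecidableEq n]
    [Fintype ι] {A : Matrix n n ℝ} (hA : A.IsHermitian) (P : Matrix n ι ℝ)
    (hP : Pᵀ * A * P = 0) (hinj : ∀ a, (A * P) *ᵥ a = 0 → a = 0) :
    Fintype.card ι ≤ Fintype.card {i // hA.eigenvalues i < 0} := by
  by_contra! hlt
  set U : Matrix n n ℝ := hA.eigenvectorUnitary.1
  have hspec : A = U * diagonal hA.eigenvalues * Uᵀ := by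
    have h := hA.spectral_theorem
    rwa [Unitary.conjStarAlgAut_apply] at h
  let f : (ι → ℝ) →ₗ[ℝ] ({i // hA.eigenvalues i < 0} → ℝ) :=
    LinearMap.funLeft ℝ ℝ Subtype.val ∘ₗ (Uᵀ * P).mulVecLin
  obtain ⟨a, ha, ha0⟩ := (Submodule.ne_bot_iff _).1
    (f.ker_ne_bot_of_finrank_lt (by simpa using hlt))
  set b := (Uᵀ * P) *ᵥ a with hb
  have hneg : ∀ i, hA.eigenvalues i < 0 → b i = 0 := fun i hi =>
    congrFun (LinearMap.mem_ker.1 ha) ⟨i, hi⟩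
  have hquad : ∑ i, hA.eigenvalues i * b i ^ 2 = 0 := by
    have hPAP : Pᵀ * A * P = (Uᵀ * P)ᵀ * (diagonal hA.eigenvalues * (Uᵀ * P)) := by
      conv_lhs => rw [hspec]
      simp only [transpose_mul, transpose_transpose, Matrix.mul_assoc]
    have h : b ⬝ᵥ (diagonal hA.eigenvalues *ᵥ b) = a ⬝ᵥ ((Pᵀ * A * P) *ᵥ a) := by
      rw [hPAP, ← mulVec_mulVec, ← mulVec_mulVec, ← hb, dotProduct_mulVec a, vecMul_transpose]
    rw [hP, zero_mulVec, dotProduct_zero] at h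
    rw [← h]
    refine Finset.sum_congr rfl fun i _ => ?_
    rw [mulVec_diagonal]
    ring
  have hterm : ∀ i, 0 ≤ hA.eigenvalues i * b i ^ 2 := fun i => by
    rcases lt_or_ge (hA.eigenvalues i) 0 with hi | hi
    · simp [hneg i hi]
    · positivity
  have hzero : diagonal hA.eigenvalues *ᵥ b = 0 := by
    funext i
    have h := (Finset.sum_eq_zero_iff_of_nonneg fun i _ => hterm i).1 hquad i (Finset.mem_univ i)
    rw [mulVec_diagonal]
    simpa using h
  refine ha0 (hinj a ?_)
  have hAP : A * P = U * (diagonal hA.eigenvalues * (Uᵀ * P)) := by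
    conv_lhs => rw [hspec]
    simp only [Matrix.mul_assoc]
  rw [hAP, ← mulVec_mulVec, ← mulVec_mulVec, ← hb, hzero, mulVec_zero]

namespace SimpleGraph

/-- An independent family of vertices `v` matched to a family `u` such that no `v i` is adjacent
to a later `u j` bounds the negative inertia index from below. -/
lemma le_negInertia_of_triangular {V : Type*} [Fintype V] (G : SimpleGraph V) {k : ℕ}
    (u v : Fin k → V) (hvv : ∀ i j, i < j → ¬ G.Adj (v i) (v j)) (huv : ∀ i, G.Adj (u i) (v i))
    (hlt : ∀ i j, i < j → ¬ G.Adj (v i) (u j)) : k ≤ G.negInertia := by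
  classical
  have hvv' : ∀ i j, ¬ G.Adj (v i) (v j) := fun i j h => by
    rcases lt_trichotomy i j with hij | rfl | hij
    · exact hvv i j hij h
    · exact G.irrefl h
    · exact hvv j i hij h.symm
  have hsub : G.adjMatrix ℝ * (1 : Matrix V V ℝ).submatrix id v
      = (G.adjMatrix ℝ).submatrix id v := by
    ext i j
    simp [Matrix.mul_apply, Matrix.one_apply]
  have hdet : IsUnit ((G.adjMatrix ℝ).submatrix u v) := by
    rw [Matrix.isUnit_iff_isUnit_det, Matrix.det_of_isUpperTriangular]
    · simp [huv]
    · intro i j hij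
      simpa [G.adj_comm] using hlt j i hij
  have key := G.adjMatrix_isHermitian.card_le_card_neg_eigenvalues
    ((1 : Matrix V V ℝ).submatrix id v) ?_ ?_
  · rw [Fintype.card_fin] at key
    unfold negInertia
    convert key
  · ext i j
    rw [Matrix.mul_assoc, hsub]
    refine Finset.sum_eq_zero fun t _ => ?_
    by_cases h : t = v i
    · subst h
      simp [hvv']
    · simp [h]
  · intro a ha
    rw [hsub] at ha
    refine Matrix.mulVec_injective_iff_isUnit.2 hdet ?_
    rw [Matrix.mulVec_zero]
    funext j
    exact congrFun ha (u j)

variable {V : Type*} {G : SimpleGraph V}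

lemma Walk.IsPath.girth_le_of_adj {u v : V} {p : G.Walk u v} (hp : p.IsPath) (hlen : p.length ≠ 1)
    (h : G.Adj v u) : G.girth ≤ p.length + 1 := by
  have hcyc : (Walk.cons h p).IsCycle := (Walk.cons_isCycle_iff p h).2
    ⟨hp, fun he => hlen (hp.length_eq_one_of_mem_edges (Sym2.eq_swap ▸ he))⟩
  simpa using girth_le_length hcyc

lemma Walk.IsPath.girth_le_of_common_adj {u v w : V} {p : G.Walk u v} (hp : p.IsPath)
    (hlen : p.length ≠ 0) (hw : w ∉ p.support) (hu : G.Adj w u) (hv : G.Adj w v) :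
    G.girth ≤ p.length + 2 := by
  have hq : (Walk.cons hu p).IsPath := (Walk.cons_isPath_iff hu p).2 ⟨hp, hw⟩
  simpa using hq.girth_le_of_adj (by simpa using hlen) hv.symm

lemma not_adj_of_common_adj {x y z : V} (hg : 3 < G.girth) (hx : G.Adj z x) (hy : G.Adj z y) :
    ¬ G.Adj x y := fun h => by
  have hle := (Walk.IsPath.of_adj h).girth_le_of_common_adj (w := z) (by simp)
    (by simp [hx.ne, hy.ne]) hx hy
  simp at hle
  omega

/-- A cycle of length at most the girth has no chord avoiding its base vertex. -/
lemma Walk.IsCycle.not_adj_getVert {a : V} {c : G.Walk a a} (hc : c.IsCycle)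
    (hlen : c.length ≤ G.girth) {i j : ℕ} (hi : 0 < i) (hij : i + 2 ≤ j) (hj : j < c.length) :
    ¬ G.Adj (c.getVert i) (c.getVert j) := fun h => by
  have hp := (hc.isPath_drop hi).take (j - i)
  have hl : ((c.drop i).take (j - i)).length = j - i := by
    rw [Walk.take_length, Walk.drop_length]
    omega
  have hend : (c.drop i).getVert (j - i) = c.getVert j := by
    rw [Walk.drop_getVert]
    congr 1
    omega
  have := hp.girth_le_of_adj (by omega) (hend ▸ h.symm)
  omega

/-- A vertex off a shortest cycle of length at least five has at most one neighbour on it. -/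
lemma Walk.IsCycle.not_adj_getVert_of_notMem {a w : V} {c : G.Walk a a} (hc : c.IsCycle)
    (hlen : c.length ≤ G.girth) (hg : 5 ≤ c.length) (hw : w ∉ c.support) (hwa : G.Adj w a)
    {i : ℕ} (hi : 0 < i) (hic : i < c.length) : ¬ G.Adj w (c.getVert i) := fun h => by
  have hl : (c.take i).length = i := by
    rw [Walk.take_length]
    omega
  have hl' : (c.drop i).length = c.length - i := Walk.drop_length ..
  have h₁ := (hc.isPath_take hic).girth_le_of_common_adj (by omega)
    (fun hm => hw ((c.isSubwalk_take i).support_subset hm)) hwa h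
  have h₂ := (hc.isPath_drop hi).girth_le_of_common_adj (by omega)
    (fun hm => hw ((c.isSubwalk_drop i).support_subset hm)) h hwa
  omega

/-- A path `y, x, w, z` ending at a vertex `z` of a shortest cycle of length at least five, with `w`
off the cycle and `y` not adjacent to it, bounds the negative inertia index from below. -/
lemma Walk.IsCycle.le_negInertia [Fintype V] {z w x y : V} {c : G.Walk z z} (hc : c.IsCycle)
    (hlen : c.length ≤ G.girth) (hg : 5 ≤ c.length) (hw : w ∉ c.support) (hwz : G.Adj w z)
    (hwx : G.Adj w x) (hxy : G.Adj x y) (hy : ∀ t ∈ c.support, ¬ G.Adj y t) :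
    (c.length - 1) / 2 + 2 ≤ G.negInertia := by
  let u : Fin ((c.length - 1) / 2 + 2) → V := fun i =>
    if i.val = 0 then x else c.getVert (2 * i.val - 2)
  let v : Fin ((c.length - 1) / 2 + 2) → V := fun i =>
    if i.val = 0 then y else if i.val = 1 then w else c.getVert (2 * i.val - 3)
  have hyw : ¬ G.Adj y w := fun h =>
    not_adj_of_common_adj (by omega) hxy hwx.symm h
  have hcyc {i : ℕ} (hi : 0 < i) (hic : i < c.length) :=
    hc.not_adj_getVert_of_notMem hlen hg hw hwz hi hic
  have hyc (i : ℕ) : ¬ G.Adj y (c.getVert i) := hy _ (c.getVert_mem_support i)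
  refine G.le_negInertia_of_triangular u v ?_ ?_ ?_
  · rintro ⟨i, hi⟩ ⟨j, hj⟩ hij
    rw [Fin.mk_lt_mk] at hij
    simp only [v]
    split_ifs <;> first | omega | assumption | exact hyc _ | skip
    · exact hcyc (by omega) (by omega)
    · exact hc.not_adj_getVert hlen (by omega) (by omega) (by omega)
  · rintro ⟨i, hi⟩
    simp only [u, v]
    split_ifs with h0 h1
    · exact hxy
    · simpa [h1] using hwz.symm
    · have := c.adj_getVert_succ (i := 2 * i - 3) (by omega)
      rw [show 2 * i - 3 + 1 = 2 * i - 2 by omega] at this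
      exact this.symm
  · rintro ⟨i, hi⟩ ⟨j, hj⟩ hij
    rw [Fin.mk_lt_mk] at hij
    simp only [u, v]
    split_ifs <;> first | omega | exact hyc _ | skip
    · exact hcyc (by omega) (by omega)
    · exact hc.not_adj_getVert hlen (by omega) (by omega) (by omega)

end SimpleGraph

/-- Let `G` be connected with girth `g ≥ 5`, `g ≡ 0, 1 (mod 4)`, not a canonical
unicyclic graph, with `n(G) = ⌈g/2⌉`, and let `C` be a shortest cycle. Then the set
of vertices at distance exactly `2` from `V(C)` is an independent set. -/
theorem secondNeighborhood_independent {V : Type*} [Fintype V] (G : SimpleGraph V)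
    (hG : G.Connected) (g : ℕ) (hgirth : G.girth = g) (hg : 5 ≤ g)
    (hmod : g % 4 = 0 ∨ g % 4 = 1) (hnc : ¬ G.IsCanonicalUnicyclic)
    (hn : G.negInertia = (g + 1) / 2)
    {a : V} (c : G.Walk a a) (hc : c.IsCycle) (hclen : c.length = g) :
    ∀ x y : V,
      (x ∉ c.support ∧ (∀ z ∈ c.support, ¬ G.Adj x z) ∧ ∃ z ∈ c.support, G.dist x z = 2) →
      (y ∉ c.support ∧ (∀ z ∈ c.support, ¬ G.Adj y z) ∧ ∃ z ∈ c.support, G.dist y z = 2) →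
      ¬ G.Adj x y := by
  classical
  rintro x y ⟨-, hxc, z, hz, hd⟩ ⟨-, hyc, -⟩ hxy
  obtain ⟨p, hp⟩ := hG.exists_walk_length_eq_dist x z
  rw [hd] at hp
  have hxw : G.Adj x (p.getVert 1) := by
    simpa using p.adj_getVert_succ (i := 0) (by omega)
  have hwz : G.Adj (p.getVert 1) z := by
    have h := p.adj_getVert_succ (i := 1) (by omega)
    rwa [p.getVert_of_length_le (i := 1 + 1) (by omega)] at h
  have hl : (c.rotate z hz).length = g := by rw [SimpleGraph.Walk.length_rotate, hclen]
  have hs (t : V) : t ∈ (c.rotate z hz).support ↔ t ∈ c.support :=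
    SimpleGraph.Walk.mem_support_rotate_iff ..
  have hle := (hc.rotate hz).le_negInertia (by omega) (by omega)
    (fun hm => hxc _ ((hs _).1 hm) hxw) hwz hxw.symm hxy (fun t ht => hyc t ((hs t).1 ht))
  omega
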